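/- arXiv:2004.05454 — 11 statements merged into one kernel-verified Lean document; each statement's English description precedes it below -/
import Mathlib

section
/- Let 0 < k < n and let x = [T; P] be an n×k quaternionic matrix with xᴴx = I_k. Then the tangential projection of the vector [0; 2P], namely [0; 2P] − (1/2)·x·(xᴴ·[0; 2P] + [0; 2P]ᴴ·x), equals −2·[T PᴴP; (PPᴴ − I_k)P]. (This is the gradient of h(x) = Re Tr(PᴴP) on the quaternionic Stiefel manifold.) -/
open Matrix Quaternion

/-- For `x = [T; P]` on the quaternionic Stiefel manifold (`xᴴx = I`),
the tangential projection of `[0; 2P]` equals `−2·[T PᴴP; (PPᴴ − I)P]`, i.e. this is the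
gradient of `h(x) = Re Tr(PᴴP)`. -/
theorem stmt_1 (n k : ℕ) (hk : 0 < k) (hkn : k < n)
    (T : Matrix (Fin (n - k)) (Fin k) ℍ[ℝ]) (P : Matrix (Fin k) (Fin k) ℍ[ℝ])
    (x : Matrix (Fin (n - k) ⊕ Fin k) (Fin k) ℍ[ℝ]) (hx : x = Matrix.fromRows T P)
    (hxx : xᴴ * x = 1)
    (u : Matrix (Fin (n - k) ⊕ Fin k) (Fin k) ℍ[ℝ])
    (hu : u = Matrix.fromRows (0 : Matrix (Fin (n - k)) (Fin k) ℍ[ℝ]) ((2 : ℍ[ℝ]) • P)) :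
    u - (2 : ℝ)⁻¹ • (x * (xᴴ * u + uᴴ * x)) =
      (-2 : ℝ) • Matrix.fromRows (T * (Pᴴ * P)) ((P * Pᴴ - 1) * P) := by
  have h2 : (2 : ℍ[ℝ]) • P = (2 : ℝ) • P := by
    rw [two_smul, two_smul]
  have hsum : xᴴ * u + uᴴ * x = (4 : ℝ) • (Pᴴ * P) := by
    rw [hu, hx, h2, conjTranspose_fromRows_eq_fromCols_conjTranspose,
      conjTranspose_fromRows_eq_fromCols_conjTranspose,
      fromCols_mul_fromRows, fromCols_mul_fromRows, two_smul, conjTranspose_add]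
    simp only [Matrix.mul_zero, conjTranspose_zero, Matrix.zero_mul, zero_add,
      Matrix.mul_add, Matrix.add_mul]
    module
  rw [hsum, hu, hx, h2, Matrix.mul_smul, fromRows_mul, Matrix.sub_mul, Matrix.one_mul,
    Matrix.mul_assoc P]
  ext1 i j
  rcases i with i | i
  · simp only [Matrix.sub_apply, Matrix.smul_apply, fromRows_apply_inl, Matrix.zero_apply]
    module
  · simp only [Matrix.sub_apply, Matrix.smul_apply, fromRows_apply_inr]
    module
end

section
/- Let 0 < k < n and let x = [T; P] be an n×k quaternionic matrix with xᴴx = I_k (equivalently TᴴT + PᴴP = I_k). Then (T PᴴP = 0 and (PPᴴ − I_k)P = 0) if and only if T Pᴴ = 0. In other words, x is a critical point of h(x) = Re Tr(PᴴP) if and only if T Pᴴ = 0. -/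
open Matrix Quaternion

lemma quat_self_mul_conjTranspose {a b : ℕ} (A : Matrix (Fin a) (Fin b) ℍ[ℝ])
    (h : A * Aᴴ = 0) : A = 0 := by
  ext1 i j
  have h1 := congrFun (congrFun h i) i
  simp only [Matrix.mul_apply, Matrix.conjTranspose_apply, Quaternion.self_mul_star,
    Matrix.zero_apply] at h1
  have h2 : ∑ j, Quaternion.normSq (A i j) = 0 := by
    have h3 : ((∑ j, Quaternion.normSq (A i j) : ℝ) : ℍ[ℝ]) = ((0 : ℝ) : ℍ[ℝ]) := by
      rw [Quaternion.coe_zero, ← h1]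
      simp only [← Quaternion.algebraMap_def, map_sum]
    exact Quaternion.coe_injective h3
  rw [Finset.sum_eq_zero_iff_of_nonneg (fun j _ => Quaternion.normSq_nonneg)] at h2
  exact Quaternion.normSq_eq_zero.mp (h2 j (Finset.mem_univ j))

/-- For `x = [T; P]` with `TᴴT + PᴴP = I`, the gradient of
`h(x) = Re Tr(PᴴP)` vanishes (both blocks `T PᴴP` and `(PPᴴ − I)P` are zero)
if and only if `T Pᴴ = 0`. -/
theorem stmt_4 (n k : ℕ) (hk : 0 < k) (hkn : k < n)
    (T : Matrix (Fin (n - k)) (Fin k) ℍ[ℝ]) (P : Matrix (Fin k) (Fin k) ℍ[ℝ])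
    (hx : Tᴴ * T + Pᴴ * P = 1) :
    (T * (Pᴴ * P) = 0 ∧ (P * Pᴴ - 1) * P = 0) ↔ T * Pᴴ = 0 := by
  constructor
  · rintro ⟨h, -⟩
    apply quat_self_mul_conjTranspose
    rw [Matrix.conjTranspose_mul, Matrix.conjTranspose_conjTranspose, Matrix.mul_assoc,
      ← Matrix.mul_assoc Pᴴ, ← Matrix.mul_assoc, h, Matrix.zero_mul]
  · intro h
    refine ⟨by rw [← Matrix.mul_assoc, h, Matrix.zero_mul], ?_⟩
    have h2 : P * Tᴴ = 0 := by
      have := congrArg Matrix.conjTranspose h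
      simpa [Matrix.conjTranspose_mul] using this
    have h3 : P * (Tᴴ * T + Pᴴ * P) = P := by rw [hx, Matrix.mul_one]
    rw [Matrix.mul_add, ← Matrix.mul_assoc, h2, Matrix.zero_mul, zero_add] at h3
    rw [Matrix.sub_mul, Matrix.one_mul, Matrix.mul_assoc, h3, sub_self]
end

section
/- Let 0 < k < n and let x = [T; P] be an n×k quaternionic matrix with TᴴT + PᴴP = I_k and T Pᴴ = 0 (a critical point of h). Then there exists a natural number q with Tr(PᴴP) = q (as a quaternion), such that q ≤ k and 2k ≤ n + q. In particular, if n ≥ 2k the possible critical values of h are the integers q = 0, 1, …, k, and if n ≤ 2k they are the integers q = 2k − n, …, k. -/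
open Matrix Quaternion

theorem re_trace_comm_aux {a b : ℕ} (X : Matrix (Fin a) (Fin b) ℍ[ℝ])
    (Y : Matrix (Fin b) (Fin a) ℍ[ℝ]) : (X * Y).trace.re = (Y * X).trace.re := by
  have hs : ∀ {c : ℕ} (f : Fin c → ℍ[ℝ]), (∑ i, f i).re = ∑ i, (f i).re := by
    intro c f
    exact map_sum (QuaternionAlgebra.reₗ (R := ℝ) (-1) 0 (-1)) f Finset.univ
  simp only [Matrix.trace, Matrix.diag, Matrix.mul_apply, hs]
  rw [Finset.sum_comm]
  refine Finset.sum_congr rfl fun i _ => Finset.sum_congr rfl fun j _ => ?_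
  simp only [Quaternion.re_mul]
  ring

theorem idem_trace_aux {m a : ℕ} (E : Matrix (Fin m) (Fin m) ℍ[ℝ])
    (N : Matrix (Fin m) (Fin a) ℍ[ℝ]) (M : Matrix (Fin a) (Fin m) ℍ[ℝ])
    (hE : E = N * M) (hi : E * E = E) :
    ∃ q : ℕ, E.trace.re = q ∧ q ≤ a := by
  set f := Matrix.toLinearMapRight' E with hf
  have hff : f ∘ₗ f = f := by
    rw [hf, ← Matrix.toLinearMapRight'_mul, hi]
  let W := LinearMap.range f
  let q := Module.finrank ℍ[ℝ] W
  let e : W ≃ₗ[ℍ[ℝ]] (Fin q → ℍ[ℝ]) := (Module.finBasis ℍ[ℝ] W).equivFun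
  let g : (Fin m → ℍ[ℝ]) →ₗ[ℍ[ℝ]] (Fin q → ℍ[ℝ]) := e.toLinearMap ∘ₗ f.rangeRestrict
  let h : (Fin q → ℍ[ℝ]) →ₗ[ℍ[ℝ]] (Fin m → ℍ[ℝ]) := W.subtype ∘ₗ e.symm.toLinearMap
  have hhg : h ∘ₗ g = f := by
    ext1 v
    ext1
    simp [h, g]
  have hgh : g ∘ₗ h = LinearMap.id := by
    apply LinearMap.ext
    intro v
    have key : f.rangeRestrict (e.symm v : W).1 = e.symm v := by
      apply Subtype.ext
      obtain ⟨u, hu⟩ := (e.symm v).2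
      change f (e.symm v).1 = (e.symm v).1
      rw [← hu]
      exact LinearMap.congr_fun hff u
    change e (f.rangeRestrict (e.symm v : W).1) = v
    rw [key]; simp
  have hE1 : E = LinearMap.toMatrixRight' g * LinearMap.toMatrixRight' h := by
    apply Matrix.toLinearMapRight'.injective
    rw [Matrix.toLinearMapRight'_mul, ← hf, ← hhg]
    simp [Matrix.toLinearMapRight']
  have hE2 : LinearMap.toMatrixRight' h * LinearMap.toMatrixRight' g = 1 := by
    apply Matrix.toLinearMapRight'.injective
    rw [Matrix.toLinearMapRight'_mul, Matrix.toLinearMapRight'_one, ← hgh]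
    simp [Matrix.toLinearMapRight']
  refine ⟨q, ?_, ?_⟩
  · rw [hE1, re_trace_comm_aux, hE2, Matrix.trace_one]
    simp
  · have h1 : f = Matrix.toLinearMapRight' M ∘ₗ Matrix.toLinearMapRight' N := by
      rw [hf, hE, Matrix.toLinearMapRight'_mul]
    have h2 : W ≤ LinearMap.range (Matrix.toLinearMapRight' M) := by
      change LinearMap.range f ≤ _
      rw [h1]; exact LinearMap.range_comp_le_range _ _
    calc q ≤ Module.finrank ℍ[ℝ] (LinearMap.range (Matrix.toLinearMapRight' M)) :=
          Submodule.finrank_mono h2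
      _ ≤ Module.finrank ℍ[ℝ] (Fin a → ℍ[ℝ]) := LinearMap.finrank_range_le _
      _ = a := by simp

/-- At a critical point `x = [T; P]` of `h` (`TᴴT + PᴴP = I`, `T Pᴴ = 0`),
the trace of `PᴴP` is a natural number `q` with `q ≤ k` and `2k ≤ n + q`.
Hence the critical values are `q = 0, …, k` when `n ≥ 2k`, and `q = 2k − n, …, k`
when `n ≤ 2k`. -/
theorem stmt_6 (n k : ℕ) (hk : 0 < k) (hkn : k < n)
    (T : Matrix (Fin (n - k)) (Fin k) ℍ[ℝ]) (P : Matrix (Fin k) (Fin k) ℍ[ℝ])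
    (hx : Tᴴ * T + Pᴴ * P = 1) (hcrit : T * Pᴴ = 0) :
    ∃ q : ℕ, (Pᴴ * P).trace = (q : ℍ[ℝ]) ∧ q ≤ k ∧ 2 * k ≤ n + q := by
  have hBA : (Tᴴ * T) * (Pᴴ * P) = 0 := by
    rw [Matrix.mul_assoc, ← Matrix.mul_assoc T, hcrit]; simp
  have hA : (Pᴴ * P) * (Pᴴ * P) = Pᴴ * P := by
    have := congrArg (· * (Pᴴ * P)) hx
    simpa only [Matrix.add_mul, hBA, zero_add, Matrix.one_mul] using this
  have hB : (Tᴴ * T) * (Tᴴ * T) = Tᴴ * T := by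
    have := congrArg ((Tᴴ * T) * ·) hx
    simpa only [Matrix.mul_add, hBA, add_zero, Matrix.mul_one] using this
  obtain ⟨q, hq, hqk⟩ := idem_trace_aux _ _ _ rfl hA
  obtain ⟨r, hr, hrk⟩ := idem_trace_aux _ _ _ rfl hB
  have hsum : (r : ℝ) + q = k := by
    have := congrArg (fun M => (Matrix.trace M).re) hx
    simp only [Matrix.trace_add, Quaternion.re_add, hq, hr, Matrix.trace_one] at this
    simpa using this
  have hsum' : r + q = k := by exact_mod_cast hsum
  refine ⟨q, ?_, hqk, by omega⟩
  have hstar : star (Pᴴ * P).trace = (Pᴴ * P).trace := by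
    rw [← Matrix.trace_conjTranspose]; simp
  rw [Quaternion.star_eq_self] at hstar
  rw [hstar, hq]
  exact Quaternion.coe_natCast q
end

section
/- Let 0 < k < n, let q be a natural number with max(0, 2k−n) ≤ q ≤ k, and set p = k − q. Let x = [T; P] be an n×k quaternionic matrix with TᴴT + PᴴP = I_k, T Pᴴ = 0, and Tr(PᴴP) = q. Then there exist quaternionic matrices m of size (n−k)×(n−k) with mᴴm = I_{n−k} and a, b of size k×k with aᴴa = I_k and bᴴb = I_k such that T = m T₀ bᴴ and P = a P₀ bᴴ, where P₀ = [[0_p, 0],[0, I_q]] (k×k) and T₀ = [[I_p, 0],[0, 0]] ((n−k)×k). Hence Sp(n−k) × Sp(k) × Sp(k) acts transitively on each critical level Σ_q. -/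
open Matrix Quaternion


lemma re_trace_conjTranspose_mul {M N : Type*} [Fintype M] [Fintype N]
    (A : Matrix M N ℍ[ℝ]) :
    ((Aᴴ * A).trace).re = ∑ j, ∑ i, Quaternion.normSq (A i j) := by
  have h : ∀ (s : Finset N) (f : N → ℍ[ℝ]), (∑ j ∈ s, f j).re = ∑ j ∈ s, (f j).re :=
    fun s f => map_sum (QuaternionAlgebra.reₗ (R := ℝ) (-1) 0 (-1)) f s
  have h' : ∀ (s : Finset M) (f : M → ℍ[ℝ]), (∑ j ∈ s, f j).re = ∑ j ∈ s, (f j).re :=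
    fun s f => map_sum (QuaternionAlgebra.reₗ (R := ℝ) (-1) 0 (-1)) f s
  simp only [Matrix.trace, Matrix.diag_apply, Matrix.mul_apply, Matrix.conjTranspose_apply, h, h']
  refine Finset.sum_congr rfl fun j _ => Finset.sum_congr rfl fun i _ => ?_
  rw [Quaternion.star_mul_self]
  simp

lemma re_trace_mul_conjTranspose {M N : Type*} [Fintype M] [Fintype N]
    (A : Matrix M N ℍ[ℝ]) :
    ((A * Aᴴ).trace).re = ((Aᴴ * A).trace).re := by
  have h := re_trace_conjTranspose_mul Aᴴ
  rw [Matrix.conjTranspose_conjTranspose] at h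
  rw [h, re_trace_conjTranspose_mul, Finset.sum_comm]
  simp [Matrix.conjTranspose_apply]

lemma re_trace_one {N : Type*} [Fintype N] [DecidableEq N] :
    ((1 : Matrix N N ℍ[ℝ]).trace).re = Fintype.card N := by
  rw [Matrix.trace_one]
  simp

lemma exists_unit_col {N : Type*} [Fintype N] [DecidableEq N] (Q : Matrix N N ℍ[ℝ])
    (hQ2 : Q * Q = Q) (hne : Q ≠ 0) :
    ∃ U : Matrix N (Fin 1) ℍ[ℝ], Uᴴ * U = 1 ∧ Q * U = U := by
  obtain ⟨j, hj⟩ : ∃ j, ∃ i, Q i j ≠ 0 := by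
    by_contra! h
    exact hne (by ext1 i j; exact h j i)
  obtain ⟨i, hi⟩ := hj
  let c : ℝ := ∑ i, Quaternion.normSq (Q i j)
  have hc : 0 < c := by
    refine Finset.sum_pos' (fun i _ => Quaternion.normSq_nonneg) ⟨i, Finset.mem_univ _, ?_⟩
    exact lt_of_le_of_ne Quaternion.normSq_nonneg
      (fun h => hi (Quaternion.normSq_eq_zero.1 h.symm))
  let v : Matrix N (Fin 1) ℍ[ℝ] := Q.submatrix id (fun _ => j)
  have hv : Q * v = v := by
    have : Q * v = (Q * Q).submatrix id (fun _ => j) := by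
      ext1 i l; simp [v, Matrix.mul_apply]
    rw [this, hQ2]
  have hvv : vᴴ * v = c • (1 : Matrix (Fin 1) (Fin 1) ℍ[ℝ]) := by
    ext1 a b
    have : a = b := Subsingleton.elim _ _
    subst this
    simp only [Matrix.mul_apply, Matrix.conjTranspose_apply, v, Matrix.submatrix_apply, id,
      Quaternion.star_mul_self, Matrix.smul_apply, Matrix.one_apply_eq, c]
    rw [← Quaternion.coe_one, Quaternion.smul_coe, mul_one]
    exact (map_sum (algebraMap ℝ ℍ[ℝ]) _ _).symm
  refine ⟨(Real.sqrt c)⁻¹ • v, ?_, ?_⟩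
  · have hs : ((Real.sqrt c)⁻¹ • v)ᴴ = (Real.sqrt c)⁻¹ • vᴴ := by
      ext1 i l
      simp [Matrix.conjTranspose_apply, Quaternion.star_smul]
    rw [hs, Matrix.smul_mul, Matrix.mul_smul, hvv, smul_smul, smul_smul]
    have : (Real.sqrt c)⁻¹ * (Real.sqrt c)⁻¹ * c = 1 := by
      have h0 : Real.sqrt c ≠ 0 := (Real.sqrt_pos.2 hc).ne'
      field_simp
      rw [Real.sq_sqrt hc.le]
    rw [this, one_smul]
  · rw [Matrix.mul_smul, hv]

lemma exists_frame {N : Type*} [Fintype N] [DecidableEq N] (r : ℕ) :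
    ∀ Q : Matrix N N ℍ[ℝ], Qᴴ = Q → Q * Q = Q → (Q.trace).re = r →
      ∃ V : Matrix N (Fin r) ℍ[ℝ], Vᴴ * V = 1 ∧ V * Vᴴ = Q := by
  induction r with
  | zero =>
    intro Q h1 h2 h3
    refine ⟨0, by ext1 i; exact i.elim0, ?_⟩
    have h4 := re_trace_conjTranspose_mul Q
    rw [h1, h2, h3] at h4
    have h5 : ∀ i j, Q i j = 0 := by
      intro i j
      have hn : ∀ j ∈ Finset.univ, 0 ≤ ∑ i, Quaternion.normSq (Q i j) :=
        fun j _ => Finset.sum_nonneg fun i _ => Quaternion.normSq_nonneg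
      have h6 := (Finset.sum_eq_zero_iff_of_nonneg hn).1 (by rw [← h4]; simp) j
        (Finset.mem_univ _)
      have h7 := (Finset.sum_eq_zero_iff_of_nonneg
        (fun i _ => Quaternion.normSq_nonneg)).1 h6 i (Finset.mem_univ _)
      exact Quaternion.normSq_eq_zero.1 h7
    ext1 i j
    simp [h5]
  | succ r ih =>
    intro Q h1 h2 h3
    have hne : Q ≠ 0 := by
      rintro rfl
      simp at h3
      have : (0:ℝ) ≤ r := Nat.cast_nonneg r
      linarith
    obtain ⟨U, hU, hQU⟩ := exists_unit_col Q h2 hne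
    have hUQ : Uᴴ * Q = Uᴴ := by
      have := congrArg Matrix.conjTranspose hQU
      rwa [Matrix.conjTranspose_mul, h1] at this
    obtain ⟨V, hV, hVV⟩ := ih (Q - U * Uᴴ)
      (by rw [Matrix.conjTranspose_sub, Matrix.conjTranspose_mul,
            Matrix.conjTranspose_conjTranspose, h1])
      (by
        have e1 : Q * (U * Uᴴ) = U * Uᴴ := by rw [← Matrix.mul_assoc, hQU]
        have e2 : U * Uᴴ * Q = U * Uᴴ := by rw [Matrix.mul_assoc, hUQ]
        have e3 : U * Uᴴ * (U * Uᴴ) = U * Uᴴ := by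
          rw [Matrix.mul_assoc, ← Matrix.mul_assoc Uᴴ, hU, Matrix.one_mul]
        rw [Matrix.sub_mul, Matrix.mul_sub, Matrix.mul_sub, h2, e1, e2, e3, sub_self, sub_zero])
      (by
        rw [Matrix.trace_sub, Quaternion.re_sub, re_trace_mul_conjTranspose, hU, re_trace_one, h3]
        simp)
    have hVU : Vᴴ * U = 0 := by
      calc Vᴴ * U = (Vᴴ * V) * (Vᴴ * U) := by rw [hV, Matrix.one_mul]
        _ = Vᴴ * ((V * Vᴴ) * U) := by simp only [Matrix.mul_assoc]
        _ = 0 := by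
          rw [hVV, Matrix.sub_mul, hQU, Matrix.mul_assoc, hU, Matrix.mul_one, sub_self,
            Matrix.mul_zero]
    have hUV : Uᴴ * V = 0 := by
      have := congrArg Matrix.conjTranspose hVU
      rwa [Matrix.conjTranspose_mul, Matrix.conjTranspose_conjTranspose,
        Matrix.conjTranspose_zero] at this
    refine ⟨(Matrix.fromCols V U).submatrix id (finSumFinEquiv (m := r) (n := 1)).symm, ?_, ?_⟩
    · rw [Matrix.conjTranspose_submatrix, ← Matrix.submatrix_mul _ _ _ id _ Function.bijective_id,
        Matrix.conjTranspose_fromCols_eq_fromRows_conjTranspose, Matrix.fromRows_mul_fromCols,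
        hV, hU, hVU, hUV, Matrix.fromBlocks_one]
      exact Matrix.submatrix_one_equiv _
    · rw [Matrix.conjTranspose_submatrix, Matrix.submatrix_mul_equiv,
        Matrix.conjTranspose_fromCols_eq_fromRows_conjTranspose, Matrix.fromCols_mul_fromRows, hVV]
      simp

lemma frame_orth {N A B : Type*} [Fintype N] [DecidableEq N] [Fintype A] [DecidableEq A]
    [Fintype B] [DecidableEq B]
    (V : Matrix N A ℍ[ℝ]) (W : Matrix N B ℍ[ℝ]) (hV : Vᴴ * V = 1) (hW : Wᴴ * W = 1)
    (h : W * Wᴴ = 1 - V * Vᴴ) : Vᴴ * W = 0 ∧ Wᴴ * V = 0 := by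
  have h1 : Vᴴ * W = 0 := by
    calc Vᴴ * W = Vᴴ * (W * Wᴴ) * W := by
          rw [Matrix.mul_assoc, Matrix.mul_assoc W, hW, Matrix.mul_one]
      _ = 0 := by
          rw [h, Matrix.mul_sub, ← Matrix.mul_assoc, hV]; simp
  refine ⟨h1, ?_⟩
  have := congrArg Matrix.conjTranspose h1
  rwa [Matrix.conjTranspose_mul, Matrix.conjTranspose_conjTranspose,
    Matrix.conjTranspose_zero] at this

lemma exists_compl {N A : Type*} [Fintype N] [DecidableEq N] [Fintype A] [DecidableEq A]
    (r : ℕ) (V : Matrix N A ℍ[ℝ]) (hV : Vᴴ * V = 1)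
    (hr : Fintype.card N = Fintype.card A + r) :
    ∃ W : Matrix N (Fin r) ℍ[ℝ], Wᴴ * W = 1 ∧ W * Wᴴ = 1 - V * Vᴴ := by
  apply exists_frame
  · simp [Matrix.conjTranspose_sub, Matrix.conjTranspose_mul]
  · have e3 : V * Vᴴ * (V * Vᴴ) = V * Vᴴ := by
      rw [Matrix.mul_assoc, ← Matrix.mul_assoc Vᴴ, hV, Matrix.one_mul]
    simp [Matrix.sub_mul, Matrix.mul_sub, e3]
  · rw [Matrix.trace_sub, Quaternion.re_sub, re_trace_mul_conjTranspose, hV, re_trace_one,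
      re_trace_one, hr]
    simp

/-- Any critical point `x = [T; P]` at level `q` (so `TᴴT + PᴴP = I`,
`TPᴴ = 0`, `Tr(PᴴP) = q`, with `max(0, 2k−n) ≤ q ≤ k` and `p = k − q`) can be written
`T = m T₀ bᴴ`, `P = a P₀ bᴴ` with `m ∈ Sp(n−k)`, `a, b ∈ Sp(k)`, where `T₀, P₀` are the
notable matrices. Hence `Sp(n−k) × Sp(k) × Sp(k)` acts transitively on `Σ_q`. -/
theorem stmt_11 (n k q : ℕ) (hk : 0 < k) (hkn : k < n)
    (hqk : q ≤ k) (hqn : 2 * k ≤ n + q) (p : ℕ) (hp : p = k - q)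
    (T : Matrix (Fin p ⊕ Fin (n - k - p)) (Fin p ⊕ Fin q) ℍ[ℝ])
    (P : Matrix (Fin p ⊕ Fin q) (Fin p ⊕ Fin q) ℍ[ℝ])
    (hx : Tᴴ * T + Pᴴ * P = 1) (hcrit : T * Pᴴ = 0)
    (hlevel : (Pᴴ * P).trace = (q : ℍ[ℝ]))
    (T₀ : Matrix (Fin p ⊕ Fin (n - k - p)) (Fin p ⊕ Fin q) ℍ[ℝ])
    (hT₀ : T₀ = Matrix.fromBlocks 1 0 0 0)
    (P₀ : Matrix (Fin p ⊕ Fin q) (Fin p ⊕ Fin q) ℍ[ℝ])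
    (hP₀ : P₀ = Matrix.fromBlocks 0 0 0 1) :
    ∃ (m : Matrix (Fin p ⊕ Fin (n - k - p)) (Fin p ⊕ Fin (n - k - p)) ℍ[ℝ])
      (a b : Matrix (Fin p ⊕ Fin q) (Fin p ⊕ Fin q) ℍ[ℝ]),
      mᴴ * m = 1 ∧ aᴴ * a = 1 ∧ bᴴ * b = 1 ∧ T = m * T₀ * bᴴ ∧ P = a * P₀ * bᴴ := by
  subst hT₀ hP₀
  have hcrit' : P * Tᴴ = 0 := by
    have := congrArg Matrix.conjTranspose hcrit
    rwa [Matrix.conjTranspose_mul, Matrix.conjTranspose_conjTranspose,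
      Matrix.conjTranspose_zero] at this
  have hPQ : P * (Pᴴ * P) = P := by
    have : P * (Tᴴ * T + Pᴴ * P) = P := by rw [hx, Matrix.mul_one]
    rwa [Matrix.mul_add, ← Matrix.mul_assoc, hcrit', Matrix.zero_mul, zero_add] at this
  have hTQ : T * (Pᴴ * P) = 0 := by rw [← Matrix.mul_assoc, hcrit, Matrix.zero_mul]
  obtain ⟨b2, hb2, hbb2⟩ := exists_frame q (Pᴴ * P)
    (by rw [Matrix.conjTranspose_mul, Matrix.conjTranspose_conjTranspose])
    (by rw [Matrix.mul_assoc, hPQ]) (by rw [hlevel]; simp)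
  obtain ⟨b1, hb1, hbb1⟩ := exists_compl p b2 hb2 (by simp [add_comm])
  obtain ⟨h21, h12⟩ := frame_orth b2 b1 hb2 hb1 hbb1
  have hTT : Tᴴ * T = b1 * b1ᴴ := by rw [hbb1, hbb2, ← hx]; simp
  have hTb : T * (b1 * b1ᴴ) = T := by rw [hbb1, hbb2, Matrix.mul_sub, hTQ]; simp
  have hPb : P * (b2 * b2ᴴ) = P := by rw [hbb2, hPQ]
  have hA : (P * b2)ᴴ * (P * b2) = 1 := by
    rw [Matrix.conjTranspose_mul, Matrix.mul_assoc, ← Matrix.mul_assoc Pᴴ, ← hbb2,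
      Matrix.mul_assoc, hb2, Matrix.mul_one, hb2]
  have hM : (T * b1)ᴴ * (T * b1) = 1 := by
    rw [Matrix.conjTranspose_mul, Matrix.mul_assoc, ← Matrix.mul_assoc Tᴴ, hTT,
      Matrix.mul_assoc, hb1, Matrix.mul_one, hb1]
  obtain ⟨A1, hA1, hAA1⟩ := exists_compl p (P * b2) hA (by simp [add_comm])
  obtain ⟨hA21, hA12⟩ := frame_orth _ _ hA hA1 hAA1
  obtain ⟨M2, hM2, hMM2⟩ := exists_compl (n - k - p) (T * b1) hM (by simp)
  obtain ⟨hM12, hM21⟩ := frame_orth _ _ hM hM2 hMM2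
  refine ⟨Matrix.fromCols (T * b1) M2, Matrix.fromCols A1 (P * b2), Matrix.fromCols b1 b2,
    ?_, ?_, ?_, ?_, ?_⟩
  · rw [Matrix.conjTranspose_fromCols_eq_fromRows_conjTranspose, Matrix.fromRows_mul_fromCols,
      hM, hM2, hM12, hM21, Matrix.fromBlocks_one]
  · rw [Matrix.conjTranspose_fromCols_eq_fromRows_conjTranspose, Matrix.fromRows_mul_fromCols,
      hA, hA1, hA12, hA21, Matrix.fromBlocks_one]
  · rw [Matrix.conjTranspose_fromCols_eq_fromRows_conjTranspose, Matrix.fromRows_mul_fromCols,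
      hb1, hb2, h12, h21, Matrix.fromBlocks_one]
  · rw [Matrix.conjTranspose_fromCols_eq_fromRows_conjTranspose, Matrix.fromCols_mul_fromBlocks,
      Matrix.fromCols_mul_fromRows]
    simp [Matrix.mul_assoc, hTb]
  · rw [Matrix.conjTranspose_fromCols_eq_fromRows_conjTranspose, Matrix.fromCols_mul_fromBlocks,
      Matrix.fromCols_mul_fromRows]
    simp [Matrix.mul_assoc, hPb]
end

section
/- Let 0 < k < n and let A = [[α, T],[β, P]] be an n×n quaternionic matrix with AᴴA = I_n, where α is (n−k)×(n−k), T is (n−k)×k, β is k×(n−k), P is k×k, and assume T Pᴴ = 0. Set x₀ = [0; I_k] (n×k), x = A x₀ = [T; P], and let v = A·[X; Y] with X an (n−k)×k quaternionic matrix and Y a k×k quaternionic matrix with Yᴴ = −Y. Then the following identities hold: (i) −2·[0; PPᴴ − I_k]·(x₀ᴴ v) = 2·[0; βX]; (ii) −2·(v xᴴ + x vᴴ)·x₀·P + 2·[0; βX] = −2·A·[X PᴴP − βᴴβ X; Xᴴβᴴ P − Pᴴβ X]. (These are the two expressions for the Hessian of h at the critical point x applied to the tangent vector v.) -/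
open Matrix Quaternion

/-- Let `A = [[α, T],[β, P]] ∈ Sp(n)` with `TPᴴ = 0`, `x₀ = [0; I_k]`,
`x = A x₀ = [T; P]`, and `v = A·[X; Y]` with `Y` skew-Hermitian. Then
(i) `−2·[0; PPᴴ − I]·(x₀ᴴv) = 2·[0; βX]` and
(ii) `−2·(vxᴴ + xvᴴ)·x₀·P + 2·[0; βX] = −2·A·[XPᴴP − βᴴβX; XᴴβᴴP − PᴴβX]`,
the two expressions for the Hessian of `h` at `x` applied to `v`. -/
theorem stmt_12 (n k : ℕ) (hk : 0 < k) (hkn : k < n)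
    (α : Matrix (Fin (n - k)) (Fin (n - k)) ℍ[ℝ]) (T : Matrix (Fin (n - k)) (Fin k) ℍ[ℝ])
    (β : Matrix (Fin k) (Fin (n - k)) ℍ[ℝ]) (P : Matrix (Fin k) (Fin k) ℍ[ℝ])
    (A : Matrix (Fin (n - k) ⊕ Fin k) (Fin (n - k) ⊕ Fin k) ℍ[ℝ])
    (hA : A = Matrix.fromBlocks α T β P) (hAA : Aᴴ * A = 1) (hcrit : T * Pᴴ = 0)
    (x₀ : Matrix (Fin (n - k) ⊕ Fin k) (Fin k) ℍ[ℝ])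
    (hx₀ : x₀ = Matrix.fromRows 0 1)
    (x : Matrix (Fin (n - k) ⊕ Fin k) (Fin k) ℍ[ℝ]) (hx : x = A * x₀)
    (X : Matrix (Fin (n - k)) (Fin k) ℍ[ℝ]) (Y : Matrix (Fin k) (Fin k) ℍ[ℝ])
    (hY : Yᴴ = -Y)
    (v : Matrix (Fin (n - k) ⊕ Fin k) (Fin k) ℍ[ℝ]) (hv : v = A * Matrix.fromRows X Y) :
    ((-2 : ℝ) • (Matrix.fromRows (0 : Matrix (Fin (n - k)) (Fin k) ℍ[ℝ]) (P * Pᴴ - 1) *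
        (x₀ᴴ * v)) =
      (2 : ℝ) • Matrix.fromRows (0 : Matrix (Fin (n - k)) (Fin k) ℍ[ℝ]) (β * X)) ∧
    ((-2 : ℝ) • ((v * xᴴ + x * vᴴ) * x₀ * P) +
        (2 : ℝ) • Matrix.fromRows (0 : Matrix (Fin (n - k)) (Fin k) ℍ[ℝ]) (β * X) =
      (-2 : ℝ) • (A * Matrix.fromRows (X * (Pᴴ * P) - βᴴ * β * X)
        (Xᴴ * βᴴ * P - Pᴴ * β * X))) := by
  have hAA' : A * Aᴴ = 1 := mul_eq_one_symm hAA
  have h1 := hAA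
  have h2 := hAA'
  rw [hA, Matrix.fromBlocks_conjTranspose, Matrix.fromBlocks_multiply, ← Matrix.fromBlocks_one,
    Matrix.fromBlocks_inj] at h1 h2
  obtain ⟨h11, h12, h21, h22⟩ := h1
  obtain ⟨g11, g12, g21, g22⟩ := h2
  have hPT : P * Tᴴ = 0 := by
    have := congrArg Matrix.conjTranspose hcrit
    simpa using this
  have hβα : β * αᴴ = 0 := by simpa [hPT] using g21
  have hβ : β * βᴴ * β = β := by
    have := congrArg (fun M => β * M) h11
    simpa [Matrix.mul_add, ← Matrix.mul_assoc, hβα] using this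
  have hβP : β * βᴴ * P = 0 := by
    have := congrArg (fun M => β * M) h12
    simpa [Matrix.mul_add, ← Matrix.mul_assoc, hβα] using this
  have hPP : P * Pᴴ - 1 = -(β * βᴴ) := by
    rw [← g22]; abel
  have hx0v : x₀ᴴ * v = β * X + P * Y := by
    rw [hx₀, hv, hA, Matrix.fromBlocks_mul_fromRows, Matrix.conjTranspose_fromRows_eq_fromCols_conjTranspose,
      Matrix.fromCols_mul_fromRows]
    simp
  have hvx0 : vᴴ * x₀ = Xᴴ * βᴴ - Y * Pᴴ := by
    have := congrArg Matrix.conjTranspose hx0v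
    simpa [hY, sub_eq_add_neg] using this
  have hx' : x = Matrix.fromRows T P := by
    rw [hx, hx₀, hA, Matrix.fromBlocks_mul_fromRows]; simp
  have hxx0 : xᴴ * x₀ = Pᴴ := by
    rw [hx', hx₀, Matrix.conjTranspose_fromRows_eq_fromCols_conjTranspose,
      Matrix.fromCols_mul_fromRows]
    simp
  constructor
  · rw [hx0v, hPP, Matrix.fromRows_mul]
    have : -(β * βᴴ) * (β * X + P * Y) = -(β * X) := by
      rw [Matrix.mul_add, Matrix.neg_mul, Matrix.neg_mul, ← Matrix.mul_assoc, ← Matrix.mul_assoc,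
        hβ, hβP]
      simp
    rw [this, Matrix.zero_mul]
    refine Matrix.ext fun i j => ?_
    cases i <;> simp
  · have hb : Matrix.fromRows (0 : Matrix (Fin (n - k)) (Fin k) ℍ[ℝ]) (β * X)
        = A * Matrix.fromRows (βᴴ * β * X) (Pᴴ * β * X) := by
      have e : Matrix.fromRows (βᴴ * β * X) (Pᴴ * β * X)
          = Aᴴ * Matrix.fromRows (0 : Matrix (Fin (n - k)) (Fin k) ℍ[ℝ]) (β * X) := by
        rw [hA, Matrix.fromBlocks_conjTranspose, Matrix.fromBlocks_mul_fromRows]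
        simp [Matrix.mul_assoc]
      rw [e, ← Matrix.mul_assoc, hAA', Matrix.one_mul]
    have hm : (v * xᴴ + x * vᴴ) * x₀ * P
        = A * Matrix.fromRows (X * (Pᴴ * P)) (Xᴴ * βᴴ * P) := by
      rw [Matrix.add_mul, Matrix.mul_assoc v, Matrix.mul_assoc x, hxx0, hvx0, hx, hv, hx₀,
        Matrix.mul_assoc A, Matrix.mul_assoc A, ← Matrix.mul_add, Matrix.mul_assoc A]
      congr 1
      rw [Matrix.add_mul, Matrix.fromRows_mul, Matrix.fromRows_mul, Matrix.fromRows_mul,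
        Matrix.fromRows_mul]
      refine Matrix.ext fun i j => ?_
      cases i <;> simp [Matrix.add_mul, Matrix.fromRows_mul, Matrix.sub_mul, Matrix.mul_assoc]
    have hs : Matrix.fromRows (X * (Pᴴ * P) - βᴴ * β * X) (Xᴴ * βᴴ * P - Pᴴ * β * X)
        = Matrix.fromRows (X * (Pᴴ * P)) (Xᴴ * βᴴ * P)
          - Matrix.fromRows (βᴴ * β * X) (Pᴴ * β * X) := by
      refine Matrix.ext fun i j => ?_
      cases i <;> simp
    rw [hm, hs, hb, Matrix.mul_sub, smul_sub, neg_smul, neg_smul, sub_neg_eq_add]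
end

section
/- Let 0 < k < n, let p be a natural number with p ≤ k and p ≤ n − k, and set q = k − p. Define the k×k quaternionic matrix P₀ = [[0_p, 0],[0, I_q]] and the k×(n−k) quaternionic matrix β₀ = [[I_p, 0],[0, 0]]. Suppose X is an (n−k)×k quaternionic matrix and Y is a k×k quaternionic matrix with Yᴴ = −Y, not both zero, and λ is a real number such that −2·(X P₀ᴴP₀ − β₀ᴴβ₀ X) = λ·X and −2·(Xᴴβ₀ᴴ P₀ − P₀ᴴβ₀ X) = λ·Y. Then λ ∈ {0, 2, −2}. (These are the eigenvalues of the Hessian of h at the notable point x₀^q.) -/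
open Matrix Quaternion

/-- Eigenvalues of the Hessian at the notable point `x₀^q`. With
`P₀ = [[0_p, 0],[0, I_q]]` and `β₀ = [[I_p, 0],[0, 0]]`, if `(X, Y) ≠ (0, 0)` with `Y`
skew-Hermitian and `λ ∈ ℝ` satisfy `−2(XP₀ᴴP₀ − β₀ᴴβ₀X) = λX` and
`−2(Xᴴβ₀ᴴP₀ − P₀ᴴβ₀X) = λY`, then `λ ∈ {0, 2, −2}`. -/
theorem stmt_14 (n k p : ℕ) (hk : 0 < k) (hkn : k < n) (hpk : p ≤ k) (hpnk : p ≤ n - k)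
    (q : ℕ) (hq : q = k - p)
    (P₀ : Matrix (Fin p ⊕ Fin q) (Fin p ⊕ Fin q) ℍ[ℝ])
    (hP₀ : P₀ = Matrix.fromBlocks 0 0 0 1)
    (β₀ : Matrix (Fin p ⊕ Fin q) (Fin p ⊕ Fin (n - k - p)) ℍ[ℝ])
    (hβ₀ : β₀ = Matrix.fromBlocks 1 0 0 0)
    (X : Matrix (Fin p ⊕ Fin (n - k - p)) (Fin p ⊕ Fin q) ℍ[ℝ])
    (Y : Matrix (Fin p ⊕ Fin q) (Fin p ⊕ Fin q) ℍ[ℝ]) (hY : Yᴴ = -Y)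
    (hnz : ¬(X = 0 ∧ Y = 0)) (lam : ℝ)
    (h1 : (-2 : ℝ) • (X * (P₀ᴴ * P₀) - β₀ᴴ * β₀ * X) = lam • X)
    (h2 : (-2 : ℝ) • (Xᴴ * β₀ᴴ * P₀ - P₀ᴴ * β₀ * X) = lam • Y) :
    lam = 0 ∨ lam = 2 ∨ lam = -2 := by
  by_contra hcon
  push Not at hcon
  obtain ⟨h0, hp, hm⟩ := hcon
  have hX : X = 0 := by
    subst hP₀ hβ₀
    obtain ⟨A, B, C, D, rfl⟩ : ∃ A B C D, X = Matrix.fromBlocks A B C D :=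
      ⟨_, _, _, _, (Matrix.fromBlocks_toBlocks X).symm⟩
    simp only [Matrix.fromBlocks_conjTranspose, Matrix.fromBlocks_multiply,
      Matrix.conjTranspose_zero, Matrix.conjTranspose_one, Matrix.mul_zero, Matrix.zero_mul,
      Matrix.mul_one, Matrix.one_mul, add_zero, zero_add, sub_eq_add_neg, Matrix.fromBlocks_neg,
      Matrix.fromBlocks_add, Matrix.fromBlocks_smul, Matrix.fromBlocks_inj, neg_zero,
      add_neg_cancel, smul_zero] at h1
    obtain ⟨hA, hB, hC, hD⟩ := h1
    have eA : (lam - 2) • A = 0 := by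
      rw [sub_smul, ← hA]; simp
    have eD : (lam + 2) • D = 0 := by
      rw [add_smul, ← hD]; simp
    have zA : A = 0 := (smul_eq_zero.mp eA).resolve_left (sub_ne_zero.mpr hp)
    have zB : B = 0 := (smul_eq_zero.mp hB.symm).resolve_left h0
    have zC : C = 0 := (smul_eq_zero.mp hC.symm).resolve_left h0
    have zD : D = 0 := (smul_eq_zero.mp eD).resolve_left
      (fun h => hm (by linarith))
    rw [zA, zB, zC, zD, Matrix.fromBlocks_zero]
  refine hnz ⟨hX, ?_⟩
  subst hX
  simp only [Matrix.conjTranspose_zero, Matrix.zero_mul, Matrix.mul_zero, sub_zero,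
    smul_zero] at h2
  exact (smul_eq_zero.mp h2.symm).resolve_left h0
end

section
/- Let 0 < k < n, let p be a natural number with p ≤ k and p ≤ n − k. Define the k×k quaternionic matrix P₀ = [[0_p, 0],[0, I_{k−p}]] and the k×(n−k) quaternionic matrix β₀ = [[I_p, 0],[0, 0]]. Consider the real vector space V of pairs (X, Y) with X an (n−k)×k quaternionic matrix and Y a k×k quaternionic matrix satisfying Yᴴ = −Y, and the real-linear endomorphism L of V given by L(X, Y) = (−2(X P₀ᴴP₀ − β₀ᴴβ₀ X), −2(Xᴴβ₀ᴴ P₀ − P₀ᴴβ₀ X)). Then the kernel of L has real dimension 4np − 8p² + 2k² + k. -/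
open Matrix Quaternion

/-- Skew-Hermitian quaternionic matrices as a real submodule. -/
def skewQ (ι : Type) [Fintype ι] : Submodule ℝ (Matrix ι ι ℍ[ℝ]) where
  carrier := {Y | Yᴴ = -Y}
  add_mem' := by
    intro a b ha hb
    simp only [Set.mem_ofPred_eq] at *
    rw [conjTranspose_add, ha, hb]; abel
  zero_mem' := by simp
  smul_mem' := by
    intro c a ha
    simp only [Set.mem_ofPred_eq] at *
    ext1 i j
    have h := congrFun (congrFun ha i) j
    simp only [conjTranspose_apply, Matrix.neg_apply, Matrix.smul_apply] at *
    rw [Quaternion.star_smul, h, smul_neg]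

lemma skewQ_apply {ι : Type} [Fintype ι] {Y : Matrix ι ι ℍ[ℝ]} (h : Y ∈ skewQ ι) (i j : ι) :
    star (Y j i) = - Y i j := by
  have h' : Yᴴ = -Y := h
  have := congrFun (congrFun h' i) j
  simpa using this

/-- Build a skew-Hermitian matrix from its strict upper part and the imaginary diagonal. -/
def mkQ {ι : Type} [Fintype ι] [LinearOrder ι]
    (f : {x : ι × ι // x.1 < x.2} → ℍ[ℝ]) (g : ι → ℝ × ℝ × ℝ) : Matrix ι ι ℍ[ℝ] :=
  fun i j => if h : i < j then f ⟨(i, j), h⟩ else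
    if h : j < i then - star (f ⟨(j, i), h⟩) else ⟨0, (g i).1, (g i).2.1, (g i).2.2⟩

/-- Coordinates on skew-Hermitian matrices. -/
noncomputable def skewEquiv (ι : Type) [Fintype ι] [LinearOrder ι] :
    skewQ ι ≃ₗ[ℝ] ({x : ι × ι // x.1 < x.2} → ℍ[ℝ]) × (ι → ℝ × ℝ × ℝ) where
  toFun Y := (fun x => Y.1 x.1.1 x.1.2,
    fun i => ((Y.1 i i).imI, (Y.1 i i).imJ, (Y.1 i i).imK))
  map_add' a b := by
    ext <;> simp
  map_smul' c a := by
    ext <;> simp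
  invFun v := ⟨mkQ v.1 v.2, by
    change (mkQ v.1 v.2)ᴴ = - mkQ v.1 v.2
    ext1 i j
    rw [conjTranspose_apply, neg_apply]
    rcases lt_trichotomy i j with h | h | h
    · simp [mkQ, h, not_lt_of_gt h]
    · subst h
      have hh : ∀ q : ℍ[ℝ], q.re = 0 → star q = -q := by
        intro q hq
        ext <;> simp [hq]
      apply hh
      simp [mkQ]
    · simp [mkQ, h, not_lt_of_gt h]⟩
  left_inv Y := by
    obtain ⟨Y, hY⟩ := Y
    apply Subtype.ext
    ext1 i j
    rcases lt_trichotomy i j with h | h | h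
    · simp [mkQ, h]
    · subst h
      have := skewQ_apply hY i i
      have h0 := congrArg (fun q => QuaternionAlgebra.re q) this
      simp at h0
      ext <;> simp [mkQ]
      linarith
    · have := skewQ_apply hY i j
      simp [mkQ, h, not_lt_of_gt h, this]
  right_inv v := by
    obtain ⟨f, g⟩ := v
    refine Prod.ext ?_ ?_
    · funext x
      obtain ⟨⟨i, j⟩, h⟩ := x
      have h' : i < j := h
      simp [mkQ, h']
    · funext i
      simp [mkQ]

lemma card_lt (ι : Type) [Fintype ι] [LinearOrder ι] :
    2 * Fintype.card {x : ι × ι // x.1 < x.2} + Fintype.card ι = Fintype.card ι ^ 2 := by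
  let e : ({x : ι × ι // x.1 < x.2} ⊕ {x : ι × ι // x.1 < x.2}) ⊕ ι → ι × ι :=
    Sum.elim (Sum.elim (fun x => x.1) (fun x => (x.1.2, x.1.1))) (fun i => (i, i))
  have he : Function.Bijective e := by
    constructor
    · rintro ((⟨⟨a, b⟩, h⟩ | ⟨⟨a, b⟩, h⟩) | a) ((⟨⟨c, d⟩, h'⟩ | ⟨⟨c, d⟩, h'⟩) | c) <;>
        simp [e] at * <;> grind
    · rintro ⟨a, b⟩
      rcases lt_trichotomy a b with h | h | h
      · exact ⟨.inl (.inl ⟨(a, b), h⟩), rfl⟩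
      · subst h; exact ⟨.inr a, rfl⟩
      · exact ⟨.inl (.inr ⟨(b, a), h⟩), rfl⟩
  have := Fintype.card_of_bijective he
  simp only [Fintype.card_sum, Fintype.card_prod] at this
  rw [pow_two, ← this]; ring

lemma finrank_skewQ (ι : Type) [Fintype ι] :
    Module.finrank ℝ (skewQ ι) = 2 * Fintype.card ι ^ 2 + Fintype.card ι := by
  classical
  let _ : LinearOrder ι := LinearOrder.lift' (Fintype.equivFin ι) (Fintype.equivFin ι).injective
  have h := card_lt ι
  rw [(skewEquiv ι).finrank_eq, Module.finrank_prod, Module.finrank_pi_fintype,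
    Module.finrank_pi_fintype]
  simp only [Quaternion.finrank_eq_four, Module.finrank_prod, Module.finrank_self,
    Finset.sum_const, Finset.card_univ, smul_eq_mul]
  lia

/-- The kernel parametrised by blocks. -/
noncomputable def paramQ (a b c : Type) [Fintype a] [Fintype b] [Fintype c] :
    ((Matrix a b ℍ[ℝ] × Matrix c a ℍ[ℝ]) × skewQ (a ⊕ b)) →ₗ[ℝ]
      (Matrix (a ⊕ c) (a ⊕ b) ℍ[ℝ] × Matrix (a ⊕ b) (a ⊕ b) ℍ[ℝ]) where
  toFun v := (fromBlocks 0 v.1.1 v.1.2 0, v.2.1)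
  map_add' u v := by
    simp [fromBlocks_add]
  map_smul' r v := by
    simp [fromBlocks_smul]

lemma paramQ_inj (a b c : Type) [Fintype a] [Fintype b] [Fintype c] :
    Function.Injective (paramQ a b c) := by
  rintro ⟨⟨B, C⟩, Y⟩ ⟨⟨B', C'⟩, Y'⟩ h
  simp only [paramQ, LinearMap.coe_mk, AddHom.coe_mk, Prod.mk.injEq, fromBlocks_inj] at h
  obtain ⟨⟨-, h1, h2, -⟩, h3⟩ := h
  rw [h1, h2, Subtype.ext h3]

/-- The kernel of the Hessian `L(X, Y) = (−2(XP₀ᴴP₀ − β₀ᴴβ₀X),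
−2(Xᴴβ₀ᴴP₀ − P₀ᴴβ₀X))` of `h` at the notable point, acting on the real vector space
of pairs `(X, Y)` with `Y` skew-Hermitian, has real dimension `4np − 8p² + 2k² + k`.
We express the kernel as the real submodule of pairs `(X, Y)` with `Y` skew-Hermitian
and `L(X, Y) = 0`. -/
theorem stmt_15 (n k p : ℕ) (hk : 0 < k) (hkn : k < n) (hpk : p ≤ k) (hpnk : p ≤ n - k)
    (P₀ : Matrix (Fin p ⊕ Fin (k - p)) (Fin p ⊕ Fin (k - p)) ℍ[ℝ])
    (hP₀ : P₀ = Matrix.fromBlocks 0 0 0 1)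
    (β₀ : Matrix (Fin p ⊕ Fin (k - p)) (Fin p ⊕ Fin (n - k - p)) ℍ[ℝ])
    (hβ₀ : β₀ = Matrix.fromBlocks 1 0 0 0) :
    ∃ K : Submodule ℝ (Matrix (Fin p ⊕ Fin (n - k - p)) (Fin p ⊕ Fin (k - p)) ℍ[ℝ] ×
        Matrix (Fin p ⊕ Fin (k - p)) (Fin p ⊕ Fin (k - p)) ℍ[ℝ]),
      (∀ v, v ∈ K ↔
        (v.2ᴴ = -v.2 ∧
          (-2 : ℝ) • (v.1 * (P₀ᴴ * P₀) - β₀ᴴ * β₀ * v.1) = 0 ∧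
          (-2 : ℝ) • (v.1ᴴ * β₀ᴴ * P₀ - P₀ᴴ * β₀ * v.1) = 0)) ∧
      Module.finrank ℝ K = 4 * n * p - 8 * p ^ 2 + 2 * k ^ 2 + k := by
  subst hP₀ hβ₀
  refine ⟨LinearMap.range (paramQ (Fin p) (Fin (k - p)) (Fin (n - k - p))), ?_, ?_⟩
  · rintro ⟨X, Y⟩
    obtain ⟨A, B, C, D, rfl⟩ : ∃ A B C D, X = fromBlocks A B C D :=
      ⟨_, _, _, _, (fromBlocks_toBlocks X).symm⟩
    have hne : (-2 : ℝ) ≠ 0 := by norm_num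
    simp only [smul_eq_zero_iff_right hne, fromBlocks_conjTranspose, fromBlocks_multiply,
      conjTranspose_zero, conjTranspose_one, mul_zero, zero_mul, mul_one, one_mul, add_zero,
      zero_add, Matrix.mul_zero, Matrix.zero_mul, Matrix.mul_one, Matrix.one_mul,
      sub_eq_zero, fromBlocks_inj, LinearMap.mem_range]
    constructor
    · rintro ⟨⟨⟨B', C'⟩, Y'⟩, h⟩
      simp only [paramQ, LinearMap.coe_mk, AddHom.coe_mk, Prod.mk.injEq, fromBlocks_inj] at h
      obtain ⟨⟨h1, h2, h3, h4⟩, h5⟩ := h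
      refine ⟨?_, ?_⟩
      · rw [← h5]; exact Y'.2
      · simp [← h1, ← h4]
    · rintro ⟨hY, ⟨h1, -, -, h4⟩, -⟩
      refine ⟨⟨⟨B, C⟩, ⟨Y, hY⟩⟩, ?_⟩
      simp [paramQ, ← h1, h4]
  · rw [LinearMap.finrank_range_of_inj (paramQ_inj _ _ _), Module.finrank_prod,
      Module.finrank_prod, finrank_skewQ, Module.finrank_matrix, Module.finrank_matrix]
    simp only [Quaternion.finrank_eq_four, Fintype.card_sum, Fintype.card_fin]
    obtain ⟨q, rfl⟩ := Nat.exists_eq_add_of_le hpk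
    obtain ⟨r, hr⟩ := Nat.exists_eq_add_of_le hpnk
    obtain rfl : n = 2 * p + q + r := by omega
    have e1 : 2 * p + q + r - (p + q) - p = r := by omega
    have e2 : p + q - p = q := by omega
    have e3 : 4 * (2 * p + q + r) * p - 8 * p ^ 2 = 4 * (q + r) * p := by
      rw [Nat.sub_eq_iff_eq_add (by nlinarith [Nat.zero_le (q * p), Nat.zero_le (r * p)])]; ring
    rw [e1, e2, e3]; ring
end

section
/- Let 0 < k < n, let p be a natural number with p ≤ k and p ≤ n − k, and set q = k − p. Define the k×k quaternionic matrix P₀ = [[0_p, 0],[0, I_q]] and the k×(n−k) quaternionic matrix β₀ = [[I_p, 0],[0, 0]]. Consider the real vector space V of pairs (X, Y) with X an (n−k)×k quaternionic matrix and Y a k×k quaternionic matrix satisfying Yᴴ = −Y, and the real-linear endomorphism L of V given by L(X, Y) = (−2(X P₀ᴴP₀ − β₀ᴴβ₀ X), −2(Xᴴβ₀ᴴ P₀ − P₀ᴴβ₀ X)). Then the eigenspace {(X, Y) ∈ V : L(X, Y) = −2·(X, Y)} has real dimension 4(n−k−p)(k−p) = 4(n−2k+q)q. (This is the index of the critical submanifold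 Σ_q.) -/
open Matrix Quaternion

/-- The `(−2)`-eigenspace of the Hessian `L(X, Y) = (−2(XP₀ᴴP₀ − β₀ᴴβ₀X),
−2(Xᴴβ₀ᴴP₀ − P₀ᴴβ₀X))` of `h` at the notable point, acting on the real vector space of
pairs `(X, Y)` with `Y` skew-Hermitian, has real dimension
`4(n−k−p)(k−p) = 4(n−2k+q)q` with `q = k − p`: this is the index of `Σ_q`. -/
theorem stmt_16 (n k p : ℕ) (hk : 0 < k) (hkn : k < n) (hpk : p ≤ k) (hpnk : p ≤ n - k)
    (q : ℕ) (hq : q = k - p)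
    (P₀ : Matrix (Fin p ⊕ Fin q) (Fin p ⊕ Fin q) ℍ[ℝ])
    (hP₀ : P₀ = Matrix.fromBlocks 0 0 0 1)
    (β₀ : Matrix (Fin p ⊕ Fin q) (Fin p ⊕ Fin (n - k - p)) ℍ[ℝ])
    (hβ₀ : β₀ = Matrix.fromBlocks 1 0 0 0) :
    ∃ E : Submodule ℝ (Matrix (Fin p ⊕ Fin (n - k - p)) (Fin p ⊕ Fin q) ℍ[ℝ] ×
        Matrix (Fin p ⊕ Fin q) (Fin p ⊕ Fin q) ℍ[ℝ]),
      (∀ v, v ∈ E ↔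
        (v.2ᴴ = -v.2 ∧
          (-2 : ℝ) • (v.1 * (P₀ᴴ * P₀) - β₀ᴴ * β₀ * v.1) = (-2 : ℝ) • v.1 ∧
          (-2 : ℝ) • (v.1ᴴ * β₀ᴴ * P₀ - P₀ᴴ * β₀ * v.1) = (-2 : ℝ) • v.2)) ∧
      Module.finrank ℝ E = 4 * (n - k - p) * (k - p) ∧
      4 * (n - k - p) * (k - p) = 4 * (n + q - 2 * k) * q := by
  subst hP₀ hβ₀
  let f : Matrix (Fin (n - k - p)) (Fin q) ℍ[ℝ] →ₗ[ℝ]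
      (Matrix (Fin p ⊕ Fin (n - k - p)) (Fin p ⊕ Fin q) ℍ[ℝ] ×
        Matrix (Fin p ⊕ Fin q) (Fin p ⊕ Fin q) ℍ[ℝ]) :=
    { toFun := fun D => (Matrix.fromBlocks 0 0 0 D, 0)
      map_add' := by
        intro a b
        simp [Matrix.fromBlocks_add]
      map_smul' := by
        intro c a
        simp [Matrix.fromBlocks_smul] }
  have hf : ∀ D, f D = (Matrix.fromBlocks 0 0 0 D, 0) := fun _ => rfl
  have hinj : Function.Injective f := by
    intro a b h
    rw [hf, hf, Prod.mk.injEq, Matrix.fromBlocks_inj] at h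
    exact h.1.2.2.2
  refine ⟨LinearMap.range f, ?_, ?_, ?_⟩
  · rintro ⟨X, Y⟩
    have h2 : (-2 : ℝ) ≠ 0 := by norm_num
    rw [smul_right_inj h2, smul_right_inj h2]
    constructor
    · rintro ⟨D, hD⟩
      rw [hf, Prod.mk.injEq] at hD
      obtain ⟨rfl, rfl⟩ := hD
      simp [Matrix.fromBlocks_conjTranspose, Matrix.fromBlocks_multiply, Matrix.mul_assoc]
    · rintro ⟨-, h1, h3⟩
      obtain ⟨A, B, C, D, rfl⟩ : ∃ A B C D, X = Matrix.fromBlocks A B C D :=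
        ⟨_, _, _, _, (Matrix.fromBlocks_toBlocks X).symm⟩
      simp only [Matrix.fromBlocks_conjTranspose, Matrix.fromBlocks_multiply, Matrix.mul_assoc,
        sub_eq_add_neg, Matrix.fromBlocks_neg, Matrix.fromBlocks_add, Matrix.fromBlocks_inj,
        conjTranspose_zero, conjTranspose_one, Matrix.mul_zero, Matrix.zero_mul, Matrix.mul_one,
        Matrix.one_mul, add_zero, zero_add, neg_zero, add_neg_cancel] at h1 h3
      obtain ⟨hA, hB, hC, -⟩ := h1
      have hA' : A = 0 := by
        have h : (2 : ℝ) • A = 0 := by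
          rw [two_smul]
          nth_rewrite 1 [← hA]
          simp
        exact (smul_eq_zero.mp h).resolve_left (by norm_num)
      refine ⟨D, ?_⟩
      rw [hf, ← h3, hA', ← hB, ← hC]
      simp
  · rw [LinearMap.finrank_range_of_inj hinj, Module.finrank_matrix, Quaternion.finrank_eq_four]
    simp only [Fintype.card_fin, hq]
    ring
  · have h : n + q - 2 * k = n - k - p := by omega
    rw [h, hq]
end

section
/- Let 0 < k < n, let p be a natural number with p ≤ k and p ≤ n − k, and set q = k − p. Define P₀ = [[0_p, 0],[0, I_q]] (k×k) and T₀ = [[I_p, 0],[0, 0]] ((n−k)×k). Let m be an (n−k)×(n−k) quaternionic matrix with mᴴm = I_{n−k}, and a, b k×k quaternionic matrices with aᴴa = I_k and bᴴb = I_k. Then m T₀ = T₀ b and a P₀ = P₀ b hold if and only if there exist quaternionic matrices m₁ (p×p), m₂ ((n−k−p)×(n−k−p)), a₁ (p×p), a₂ (q×q) with m₁ᴴm₁ = I_p, m₂ᴴm₂ = I_{n−k−p}, a₁ᴴa₁ = I_p, a₂ᴴa₂ = I_q, such that m = diag(m₁, m₂), a = diag(a₁, a₂), and b = diag(m₁,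 a₂). (This identifies the isotropy subgroup L_{n,k,q} = Sp(p) × Sp(n−k−p) × Sp(p) × Sp(q) of the notable point x₀^q under the action of Sp(n−k) × Sp(k) × Sp(k).) -/
open Matrix Quaternion

theorem aux_unitary_zero {r s : ℕ} (u : Matrix (Fin r) (Fin r) ℍ[ℝ]) (x : Matrix (Fin r) (Fin s) ℍ[ℝ])
    (hu : uᴴ * u = 1) (hx : uᴴ * x = 0) : x = 0 := by
  have h : u * uᴴ = 1 := mul_eq_one_comm.mp hu
  calc x = (u * uᴴ) * x := by rw [h, Matrix.one_mul]
    _ = 0 := by rw [Matrix.mul_assoc, hx, Matrix.mul_zero]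

/-- Isotropy subgroup of the notable point `x₀^q = [T₀; P₀]` under the
action of `Sp(n−k) × Sp(k) × Sp(k)`: for symplectic `m, a, b`, the equations
`mT₀ = T₀b` and `aP₀ = P₀b` hold iff `m = diag(m₁, m₂)`, `a = diag(a₁, a₂)` and
`b = diag(m₁, a₂)` with `m₁ ∈ Sp(p)`, `m₂ ∈ Sp(n−k−p)`, `a₁ ∈ Sp(p)`, `a₂ ∈ Sp(q)`.
Hence `L_{n,k,q} = Sp(p) × Sp(n−k−p) × Sp(p) × Sp(q)`. -/
theorem stmt_17 (n k p : ℕ) (hk : 0 < k) (hkn : k < n) (hpk : p ≤ k) (hpnk : p ≤ n - k)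
    (q : ℕ) (hq : q = k - p)
    (P₀ : Matrix (Fin p ⊕ Fin q) (Fin p ⊕ Fin q) ℍ[ℝ])
    (hP₀ : P₀ = Matrix.fromBlocks 0 0 0 1)
    (T₀ : Matrix (Fin p ⊕ Fin (n - k - p)) (Fin p ⊕ Fin q) ℍ[ℝ])
    (hT₀ : T₀ = Matrix.fromBlocks 1 0 0 0)
    (m : Matrix (Fin p ⊕ Fin (n - k - p)) (Fin p ⊕ Fin (n - k - p)) ℍ[ℝ])
    (hm : mᴴ * m = 1)
    (a b : Matrix (Fin p ⊕ Fin q) (Fin p ⊕ Fin q) ℍ[ℝ])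
    (ha : aᴴ * a = 1) (hb : bᴴ * b = 1) :
    (m * T₀ = T₀ * b ∧ a * P₀ = P₀ * b) ↔
      ∃ (m₁ : Matrix (Fin p) (Fin p) ℍ[ℝ])
        (m₂ : Matrix (Fin (n - k - p)) (Fin (n - k - p)) ℍ[ℝ])
        (a₁ : Matrix (Fin p) (Fin p) ℍ[ℝ]) (a₂ : Matrix (Fin q) (Fin q) ℍ[ℝ]),
        m₁ᴴ * m₁ = 1 ∧ m₂ᴴ * m₂ = 1 ∧ a₁ᴴ * a₁ = 1 ∧ a₂ᴴ * a₂ = 1 ∧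
        m = Matrix.fromBlocks m₁ 0 0 m₂ ∧
        a = Matrix.fromBlocks a₁ 0 0 a₂ ∧
        b = Matrix.fromBlocks m₁ 0 0 a₂ := by
  subst hP₀ hT₀
  constructor
  · rintro ⟨h1, h2⟩
    obtain ⟨m11, m12, m21, m22, rfl⟩ : ∃ A B C D, m = Matrix.fromBlocks A B C D :=
      ⟨_, _, _, _, (Matrix.fromBlocks_toBlocks m).symm⟩
    obtain ⟨a11, a12, a21, a22, rfl⟩ : ∃ A B C D, a = Matrix.fromBlocks A B C D :=
      ⟨_, _, _, _, (Matrix.fromBlocks_toBlocks a).symm⟩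
    obtain ⟨b11, b12, b21, b22, rfl⟩ : ∃ A B C D, b = Matrix.fromBlocks A B C D :=
      ⟨_, _, _, _, (Matrix.fromBlocks_toBlocks b).symm⟩
    simp only [Matrix.fromBlocks_multiply, Matrix.fromBlocks_inj, Matrix.mul_one, Matrix.one_mul,
      Matrix.mul_zero, Matrix.zero_mul, add_zero, zero_add] at h1 h2
    obtain ⟨rfl, h12, rfl, -⟩ := h1
    obtain ⟨-, rfl, h21, rfl⟩ := h2
    subst h12 h21
    rw [Matrix.fromBlocks_conjTranspose, Matrix.fromBlocks_multiply, ← Matrix.fromBlocks_one,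
      Matrix.fromBlocks_inj] at hm ha hb
    simp only [Matrix.conjTranspose_zero,
      Matrix.mul_zero, Matrix.zero_mul, add_zero, zero_add] at hm ha hb
    obtain ⟨hm1, hm2, -, hm4⟩ := hm
    obtain ⟨ha1, -, ha3, ha4⟩ := ha
    have e1 := aux_unitary_zero _ _ hm1 hm2
    have e2 := aux_unitary_zero _ _ ha4 ha3
    subst e1 e2
    refine ⟨m11, m22, a11, a22, hm1, ?_, ?_, ha4, rfl, rfl, rfl⟩
    · simpa using hm4
    · simpa using ha1
  · rintro ⟨m₁, m₂, a₁, a₂, -, -, -, -, rfl, rfl, rfl⟩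
    constructor <;> simp [Matrix.fromBlocks_multiply]
end

section
/- Let k ≥ 1, let p, q, r be natural numbers with p + q + r = k, let a, b be k×k quaternionic matrices with aᴴa = I_k and bᴴb = I_k, and let C₁, …, C_q be positive real numbers. For each i define c_i(t) = sqrt(C_i e^{4t} / (1 + C_i e^{4t})). Define P : ℝ → (k×k quaternionic matrices) by P(t) = a · D(t) · bᴴ, where D(t) is the block diagonal matrix diag(I_p, diag(c₁(t), …, c_q(t)), 0_r) with real entries. Then for every t ∈ ℝ, P is differentiable at t with derivative P'(t) = −2·(P(t)·P(t)ᴴ − I_k)·P(t). That is, P solves the gradient-flow equation P' = −2(PPᴴ − I)P of the function h. -/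
open Matrix Quaternion

attribute [local instance] Matrix.frobeniusNormedAddCommGroup Matrix.frobeniusNormedSpace

/-- The scalar flow equation. -/
theorem stmt_18_scalar (C : ℝ) (hC : 0 < C) (t : ℝ) :
    HasDerivAt (fun t => Real.sqrt (C * Real.exp (4 * t) / (1 + C * Real.exp (4 * t))))
      (-2 * (Real.sqrt (C * Real.exp (4 * t) / (1 + C * Real.exp (4 * t))) ^ 3
        - Real.sqrt (C * Real.exp (4 * t) / (1 + C * Real.exp (4 * t))))) t := by
  have hE : HasDerivAt (fun t : ℝ => C * Real.exp (4 * t)) (C * (Real.exp (4 * t) * 4)) t := by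
    have h4 : HasDerivAt (fun t : ℝ => 4 * t) 4 t := by
      simpa using (hasDerivAt_id t).const_mul (4 : ℝ)
    exact h4.exp.const_mul C
  have hpos : 0 < C * Real.exp (4 * t) := by positivity
  have hne : 1 + C * Real.exp (4 * t) ≠ 0 := by positivity
  have hu : 0 < C * Real.exp (4 * t) / (1 + C * Real.exp (4 * t)) := by positivity
  have h := (hE.div (hE.const_add 1) hne).sqrt hu.ne'
  refine h.congr_deriv ?_
  have hs := Real.sqrt_pos.2 hu
  have hsq := Real.sq_sqrt hu.le
  simp only [Pi.div_apply] at *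
  generalize Real.sqrt (C * Real.exp (4 * t) / (1 + C * Real.exp (4 * t))) = s at *
  have h3 : s ^ 4 = (C * Real.exp (4 * t) / (1 + C * Real.exp (4 * t))) ^ 2 := by
    rw [← hsq]; ring
  rw [div_eq_iff (by positivity)]
  have : -2 * (s ^ 3 - s) * (2 * s) = 4 * (s ^ 2 - s ^ 4) := by ring
  rw [this, h3, hsq]
  field_simp
  try ring

/-- The linear map `v ↦ a·diag(0, diag(v), 0)·b`. -/
noncomputable def stmt_18_lin (p q r : ℕ)
    (a b : Matrix (Fin p ⊕ (Fin q ⊕ Fin r)) (Fin p ⊕ (Fin q ⊕ Fin r)) ℍ[ℝ]) :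
    (Fin q → ℝ) →ₗ[ℝ] Matrix (Fin p ⊕ (Fin q ⊕ Fin r)) (Fin p ⊕ (Fin q ⊕ Fin r)) ℍ[ℝ] where
  toFun v := a * Matrix.fromBlocks 0 0 0
      (Matrix.fromBlocks (Matrix.diagonal fun i => ((v i : ℝ) : ℍ[ℝ])) 0 0 0) * b
  map_add' v w := by
    rw [← add_mul, ← mul_add, Matrix.fromBlocks_add, Matrix.fromBlocks_add, Matrix.diagonal_add]
    simp
  map_smul' s v := by
    simp only [RingHom.id_apply]
    rw [← Matrix.smul_mul, ← Matrix.mul_smul, Matrix.fromBlocks_smul, Matrix.fromBlocks_smul,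
      ← Matrix.diagonal_smul]
    congr 4
    · simp
    · simp
    · simp
    · congr 1
      · congr 1
        funext i
        simp [← Quaternion.coe_mul_eq_smul]
      all_goals simp
    all_goals simp

/-- With `p + q + r = k`, `a, b ∈ Sp(k)`, positive constants `Cᵢ` and
`cᵢ(t) = sqrt(Cᵢe^{4t}/(1 + Cᵢe^{4t}))`, the curve `P(t) = a·diag(I_p, diag(cᵢ(t)), 0_r)·bᴴ`
solves the gradient-flow equation `P' = −2(PPᴴ − I)P` of `h`. -/
theorem stmt_18 (k p q r : ℕ) (hk : 1 ≤ k) (hpqr : p + q + r = k)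
    (a b : Matrix (Fin p ⊕ (Fin q ⊕ Fin r)) (Fin p ⊕ (Fin q ⊕ Fin r)) ℍ[ℝ])
    (ha : aᴴ * a = 1) (hb : bᴴ * b = 1)
    (C : Fin q → ℝ) (hC : ∀ i, 0 < C i)
    (c : Fin q → ℝ → ℝ)
    (hc : ∀ i t, c i t = Real.sqrt (C i * Real.exp (4 * t) / (1 + C i * Real.exp (4 * t))))
    (D : ℝ → Matrix (Fin p ⊕ (Fin q ⊕ Fin r)) (Fin p ⊕ (Fin q ⊕ Fin r)) ℍ[ℝ])
    (hD : ∀ t, D t = Matrix.fromBlocks 1 0 0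
      (Matrix.fromBlocks (Matrix.diagonal fun i => ((c i t : ℝ) : ℍ[ℝ])) 0 0 0))
    (P : ℝ → Matrix (Fin p ⊕ (Fin q ⊕ Fin r)) (Fin p ⊕ (Fin q ⊕ Fin r)) ℍ[ℝ])
    (hP : ∀ t, P t = a * D t * bᴴ) (t : ℝ) :
    HasDerivAt P ((-2 : ℝ) • ((P t * (P t)ᴴ - 1) * P t)) t := by
  have hcd : HasDerivAt (fun t => fun i => c i t) (fun i => -2 * (c i t ^ 3 - c i t)) t := by
    rw [hasDerivAt_pi]
    intro i
    have h := stmt_18_scalar (C i) (hC i) t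
    have e : c i = fun t => Real.sqrt (C i * Real.exp (4 * t) / (1 + C i * Real.exp (4 * t))) :=
      funext (hc i)
    rw [e]
    exact h
  have hPe : P = fun t => a * Matrix.fromBlocks 1 0 0 0 * bᴴ
      + (stmt_18_lin p q r a bᴴ).toContinuousLinearMap (fun i => c i t) := by
    funext t
    rw [hP, hD]
    simp only [stmt_18_lin, LinearMap.coe_toContinuousLinearMap', LinearMap.coe_mk, AddHom.coe_mk]
    rw [← add_mul, ← mul_add, Matrix.fromBlocks_add]
    simp
  have hL := ((stmt_18_lin p q r a bᴴ).toContinuousLinearMap.hasFDerivAt.comp_hasDerivAt t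
    hcd).const_add (a * Matrix.fromBlocks 1 0 0 0 * bᴴ)
  have hval : (-2 : ℝ) • ((P t * (P t)ᴴ - 1) * P t)
      = (stmt_18_lin p q r a bᴴ).toContinuousLinearMap (fun i => -2 * (c i t ^ 3 - c i t)) := by
    have hDH : (D t)ᴴ = D t := by
      rw [hD, Matrix.fromBlocks_conjTranspose, Matrix.fromBlocks_conjTranspose,
        Matrix.diagonal_conjTranspose]
      simp [Pi.star_def]
    have h1 : (P t * (P t)ᴴ - 1) * P t = a * (D t * D t * D t - D t) * bᴴ := by
      rw [hP, Matrix.conjTranspose_mul, Matrix.conjTranspose_mul, hDH,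
        Matrix.conjTranspose_conjTranspose, sub_mul, one_mul, mul_sub, sub_mul]
      congr 1
      calc a * D t * bᴴ * (b * (D t * aᴴ)) * (a * D t * bᴴ)
          = a * D t * (bᴴ * b) * D t * (aᴴ * a) * D t * bᴴ := by simp only [mul_assoc]
        _ = _ := by rw [ha, hb]; simp only [mul_assoc, mul_one, one_mul]
    have h2 : (fun i => -2 * (c i t ^ 3 - c i t))
      = (-2 : ℝ) • (fun i => c i t ^ 3 - c i t) := by
      funext i; simp
    rw [h1, h2, map_smul]
    congr 1
    simp only [stmt_18_lin, LinearMap.coe_toContinuousLinearMap', LinearMap.coe_mk, AddHom.coe_mk]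
    congr 2
    rw [hD]
    simp only [Matrix.fromBlocks_multiply, sub_eq_add_neg, Matrix.fromBlocks_neg,
      Matrix.fromBlocks_add, Matrix.diagonal_mul_diagonal, Matrix.diagonal_neg,
      Matrix.diagonal_add]
    simp [pow_succ, Matrix.fromBlocks_multiply, Matrix.fromBlocks_add, Matrix.diagonal_add]
  rw [hval, hPe]
  exact hL
end

section
/- Let 0 < k < n, let p, q, r be natural numbers with p + q + r = k and p' + q + r = n − k for some natural number p', let m be an (n−k)×(n−k) quaternionic matrix with mᴴm = I_{n−k}, let a, b be k×k quaternionic matrices with aᴴa = I_k and bᴴb = I_k, and let C₁, …, C_q be positive real numbers. For each i define c_i(t) = sqrt(C_i e^{4t} / (1 + C_i e^{4t})) and s_i(t) = sqrt(1 / (1 + C_i e^{4t})), so s_i(t)² + c_i(t)² = 1. Define P(t) = a · diag(I_p, diag(c₁(t), …, c_q(t)), 0_r) · bᴴ (k×k) and T(t) = m · E(t) · bᴴ ((n−k)×k), where E(t) is the block matrix with p'×p zero block in the top-left, diag(−s₁(t), …, −s_q(t)) in the middle, and −I_r in the bottom-right, all other blocks zero. Then for every t ∈ ℝ: (i) T is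 differentiable at t with T'(t) = −2·T(t)·P(t)ᴴ·P(t), and (ii) T(t)ᴴT(t) + P(t)ᴴP(t) = I_k, so the curve α(t) = [T(t); P(t)] stays on the Stiefel manifold X_{n,k} and completely integrates the gradient flow of h. -/
open Matrix Quaternion

attribute [local instance] Matrix.frobeniusNormedAddCommGroup Matrix.frobeniusNormedSpace

/-- With `p + q + r = k`, `p' + q + r = n − k`, `m ∈ Sp(n−k)`,
`a, b ∈ Sp(k)`, positive constants `Cᵢ`, `cᵢ(t) = sqrt(Cᵢe^{4t}/(1 + Cᵢe^{4t}))` and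
`sᵢ(t) = sqrt(1/(1 + Cᵢe^{4t}))`, the curves
`P(t) = a·diag(I_p, diag(cᵢ(t)), 0_r)·bᴴ` and
`T(t) = m·[[0, 0, 0],[0, diag(−sᵢ(t)), 0],[0, 0, −I_r]]·bᴴ`
satisfy (i) `T' = −2TPᴴP` and (ii) `TᴴT + PᴴP = I_k`, so `α(t) = [T(t); P(t)]` stays on
the Stiefel manifold and integrates the gradient flow of `h`. -/
theorem stmt_19 (n k p q r p' : ℕ) (hk : 0 < k) (hkn : k < n)
    (hpqr : p + q + r = k) (hp' : p' + q + r = n - k)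
    (m : Matrix (Fin p' ⊕ (Fin q ⊕ Fin r)) (Fin p' ⊕ (Fin q ⊕ Fin r)) ℍ[ℝ])
    (hm : mᴴ * m = 1)
    (a b : Matrix (Fin p ⊕ (Fin q ⊕ Fin r)) (Fin p ⊕ (Fin q ⊕ Fin r)) ℍ[ℝ])
    (ha : aᴴ * a = 1) (hb : bᴴ * b = 1)
    (C : Fin q → ℝ) (hC : ∀ i, 0 < C i)
    (c s : Fin q → ℝ → ℝ)
    (hc : ∀ i t, c i t = Real.sqrt (C i * Real.exp (4 * t) / (1 + C i * Real.exp (4 * t))))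
    (hs : ∀ i t, s i t = Real.sqrt (1 / (1 + C i * Real.exp (4 * t))))
    (P : ℝ → Matrix (Fin p ⊕ (Fin q ⊕ Fin r)) (Fin p ⊕ (Fin q ⊕ Fin r)) ℍ[ℝ])
    (hP : ∀ t, P t = a * Matrix.fromBlocks 1 0 0
      (Matrix.fromBlocks (Matrix.diagonal fun i => ((c i t : ℝ) : ℍ[ℝ])) 0 0 0) * bᴴ)
    (T : ℝ → Matrix (Fin p' ⊕ (Fin q ⊕ Fin r)) (Fin p ⊕ (Fin q ⊕ Fin r)) ℍ[ℝ])
    (hT : ∀ t, T t = m * (Matrix.fromBlocks 0 0 0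
      (Matrix.fromBlocks (Matrix.diagonal fun i => ((-(s i t) : ℝ) : ℍ[ℝ])) 0 0 (-1)) :
        Matrix (Fin p' ⊕ (Fin q ⊕ Fin r)) (Fin p ⊕ (Fin q ⊕ Fin r)) ℍ[ℝ]) * bᴴ)
    (t : ℝ) :
    HasDerivAt T ((-2 : ℝ) • (T t * ((P t)ᴴ * P t))) t ∧
    (T t)ᴴ * T t + (P t)ᴴ * P t = 1 := by
  have hb' : b * bᴴ = 1 := mul_eq_one_comm.mp hb
  have hpos : ∀ i t, 0 < 1 + C i * Real.exp (4 * t) := fun i t => by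
    have := hC i; positivity
  have hc2 : ∀ i, c i t * c i t = C i * Real.exp (4 * t) / (1 + C i * Real.exp (4 * t)) := by
    intro i
    rw [hc, Real.mul_self_sqrt]
    have := hC i; positivity
  have hs2 : ∀ i, s i t * s i t = 1 / (1 + C i * Real.exp (4 * t)) := by
    intro i
    rw [hs, Real.mul_self_sqrt]
    have := hC i; positivity
  have hsc : ∀ i, s i t * s i t + c i t * c i t = 1 := by
    intro i
    rw [hc2, hs2]
    have := (hpos i t).ne'
    field_simp
  have hsd : ∀ i, HasDerivAt (s i) (-2 * s i t * (c i t * c i t)) t := by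
    intro i
    have hfun : s i = fun t => Real.sqrt (1 / (1 + C i * Real.exp (4 * t))) := funext (hs i)
    have h1 : HasDerivAt (fun t => 1 + C i * Real.exp (4 * t))
        (C i * (Real.exp (4 * t) * 4)) t := by
      have h0 : HasDerivAt (fun t : ℝ => 4 * t) 4 t := by
        simpa using (hasDerivAt_id t).const_mul (4 : ℝ)
      exact (h0.exp.const_mul (C i)).const_add 1
    have h2 := (h1.fun_inv (hpos i t).ne').sqrt (inv_pos.mpr (hpos i t)).ne'
    have hfun' : s i = fun t => Real.sqrt ((1 + C i * Real.exp (4 * t))⁻¹) := by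
      simpa only [one_div] using hfun
    rw [← hfun'] at h2
    convert h2 using 1
    have hst : Real.sqrt ((1 + C i * Real.exp (4 * t))⁻¹) = s i t := by rw [hs, one_div]
    rw [hst, hc2]
    have hspos : 0 < s i t := by
      rw [← hst]; exact Real.sqrt_pos.mpr (inv_pos.mpr (hpos i t))
    have h4 := hs2 i
    have h5 := (hpos i t).ne'
    rw [eq_div_iff h5] at h4
    have h6 := hspos.ne'
    field_simp
    linear_combination (-4) * C i * h4
  have hPP : (P t)ᴴ * P t = b * Matrix.fromBlocks 1 0 0
      (Matrix.fromBlocks (Matrix.diagonal fun i => ((c i t * c i t : ℝ) : ℍ[ℝ])) 0 0 0) * bᴴ := by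
    rw [hP]
    simp only [conjTranspose_mul, conjTranspose_conjTranspose, Matrix.mul_assoc]
    rw [← Matrix.mul_assoc aᴴ a, ha, Matrix.one_mul]
    congr 1
    rw [← Matrix.mul_assoc]
    congr 1
    simp [fromBlocks_conjTranspose, fromBlocks_multiply, diagonal_conjTranspose, Function.comp_def,
      Pi.star_def]
  have hTT : (T t)ᴴ * T t = b * Matrix.fromBlocks 0 0 0
      (Matrix.fromBlocks (Matrix.diagonal fun i => ((s i t * s i t : ℝ) : ℍ[ℝ])) 0 0 1) * bᴴ := by
    rw [hT]
    simp only [conjTranspose_mul, conjTranspose_conjTranspose, Matrix.mul_assoc]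
    rw [← Matrix.mul_assoc mᴴ m, hm, Matrix.one_mul]
    congr 1
    rw [← Matrix.mul_assoc]
    congr 1
    simp [fromBlocks_conjTranspose, fromBlocks_multiply, diagonal_conjTranspose, Function.comp_def,
      Pi.star_def]
  refine ⟨?_, ?_⟩
  · let L : (Fin q → ℝ) →ₗ[ℝ] Matrix (Fin p' ⊕ (Fin q ⊕ Fin r)) (Fin p ⊕ (Fin q ⊕ Fin r)) ℍ[ℝ] :=
      { toFun := fun v => m * (Matrix.fromBlocks 0 0 0
          (Matrix.fromBlocks (Matrix.diagonal fun i => ((-(v i) : ℝ) : ℍ[ℝ])) 0 0 0) :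
          Matrix (Fin p' ⊕ (Fin q ⊕ Fin r)) (Fin p ⊕ (Fin q ⊕ Fin r)) ℍ[ℝ]) * bᴴ
        map_add' := by
          intro v w
          rw [← Matrix.add_mul, ← Matrix.mul_add, fromBlocks_add, fromBlocks_add, diagonal_add]
          simp [add_comm]
        map_smul' := by
          intro x v
          rw [RingHom.id_apply, ← Matrix.smul_mul, ← Matrix.mul_smul, fromBlocks_smul,
            fromBlocks_smul, ← diagonal_smul]
          have hx : (fun i => ((-((x • v) i) : ℝ) : ℍ[ℝ])) =
              x • fun i => ((-(v i) : ℝ) : ℍ[ℝ]) := by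
            funext i
            ext <;> simp
          simp only [hx, smul_zero] }
    have hTL : T = fun t => L (fun i => s i t) + m * (Matrix.fromBlocks 0 0 0
          (Matrix.fromBlocks 0 0 0 (-1)) :
          Matrix (Fin p' ⊕ (Fin q ⊕ Fin r)) (Fin p ⊕ (Fin q ⊕ Fin r)) ℍ[ℝ]) * bᴴ := by
      funext t
      rw [hT]
      simp only [L, LinearMap.coe_mk, AddHom.coe_mk]
      rw [← Matrix.add_mul, ← Matrix.mul_add, fromBlocks_add, fromBlocks_add]
      simp
    have hv : HasDerivAt (fun t => fun i => s i t) (fun i => -2 * s i t * (c i t * c i t)) t :=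
      hasDerivAt_pi.mpr hsd
    have hd := (L.toContinuousLinearMap.hasFDerivAt.comp_hasDerivAt t hv).add_const
      (m * (Matrix.fromBlocks 0 0 0
          (Matrix.fromBlocks 0 0 0 (-1)) :
          Matrix (Fin p' ⊕ (Fin q ⊕ Fin r)) (Fin p ⊕ (Fin q ⊕ Fin r)) ℍ[ℝ]) * bᴴ)
    have hval : (-2 : ℝ) • (T t * ((P t)ᴴ * P t)) = L (fun i => -2 * s i t * (c i t * c i t)) := by
      rw [hPP, hT]
      simp only [L, LinearMap.coe_mk, AddHom.coe_mk, Matrix.mul_assoc]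
      rw [← Matrix.mul_assoc bᴴ b, hb, Matrix.one_mul, ← Matrix.mul_smul]
      congr 1
      rw [← Matrix.mul_assoc, ← Matrix.smul_mul]
      congr 1
      rw [fromBlocks_multiply, fromBlocks_multiply, fromBlocks_smul]
      simp only [Matrix.zero_mul, Matrix.mul_zero, add_zero, zero_add, smul_zero,
        diagonal_mul_diagonal, fromBlocks_smul, ← diagonal_smul]
      congr 2
      congr 1
      funext i
      ext <;> simp <;> ring
    rw [hval, hTL]
    exact hd
  · rw [hTT, hPP, ← Matrix.add_mul, ← Matrix.mul_add, fromBlocks_add, fromBlocks_add, diagonal_add]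
    have : ∀ i, ((s i t * s i t : ℝ) : ℍ[ℝ]) + ((c i t * c i t : ℝ) : ℍ[ℝ]) = 1 := by
      intro i
      rw [← Quaternion.coe_add, hsc, Quaternion.coe_one]
    simp only [this]
    simp [hb']
end
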